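/- arXiv:1908.04331 — 10 statements merged into one kernel-verified Lean document; each statement's English description precedes it below -/
import Mathlib

section
/- Let f : ℝ^d → ℝ satisfy: (a) 0 ≤ f ≤ 1 and sup_{x ∈ ℝ^d} f(x) = 1; (b) f is continuous on ℝ^d; (c) f is twice continuously differentiable on an open neighbourhood of each point of A = argmax f = {x : f(x) = 1}; (d) f(x) → 0 as ‖x‖ → ∞. For n ≥ 1 and x ∈ ℝ^d define f_{s_n}(x) = sup { ∏_{i=1}^n f(xᵢ) : x₁, …, xₙ ∈ ℝ^d, (x₁ + ⋯ + xₙ)/n = x }. Then for every x ∈ ℝ^d, lim_{n→∞} f_{s_n}(x) = 1 if x belongs to the convex hull of A, and lim_{n→∞} f_{s_n}(x) = 0 otherwise. -/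
open Real Finset Filter

/-- The convex hull of a compact set in a finite dimensional space is compact. -/
theorem aux_hull_compact {d : ℕ} {A : Set (EuclideanSpace ℝ (Fin d))} (hA : IsCompact A) :
    IsCompact (convexHull ℝ A) := by
  have key : convexHull ℝ A = ⋃ k ∈ Set.Iic (d + 1),
      (fun p : (Fin k → ℝ) × (Fin k → EuclideanSpace ℝ (Fin d)) => ∑ i, p.1 i • p.2 i) ''
        ((stdSimplex ℝ (Fin k)) ×ˢ (Set.univ.pi fun _ => A)) := by
    apply Set.Subset.antisymm
    · intro x hx
      obtain ⟨ι, _, z, w, hz, hai, hw, hw1, hx⟩ := eq_pos_convex_span_of_mem_convexHull hx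
      simp only [Set.mem_iUnion]
      have hcard : Fintype.card ι ≤ d + 1 := by
        have h1 := hai.card_le_finrank_succ
        have h2 := Submodule.finrank_le (vectorSpan ℝ (Set.range z))
        rw [finrank_euclideanSpace_fin] at h2
        omega
      let e := Fintype.equivFin ι
      refine ⟨Fintype.card ι, hcard, (w ∘ e.symm, z ∘ e.symm), ⟨⟨?_, ?_⟩, ?_⟩, ?_⟩
      · intro i; exact (hw _).le
      · rw [← hw1]; exact Equiv.sum_comp e.symm w
      · intro i _; exact hz ⟨_, rfl⟩
      · rw [← hx]; exact Equiv.sum_comp e.symm (fun i => w i • z i)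
    · intro x hx
      simp only [Set.mem_iUnion] at hx
      obtain ⟨k, -, ⟨w, z⟩, ⟨⟨hw, hw1⟩, hz⟩, rfl⟩ := hx
      exact (convex_convexHull ℝ A).sum_mem (fun i _ => hw i) hw1
        (fun i _ => subset_convexHull ℝ A (hz i trivial))
  rw [key]
  refine (Set.finite_Iic (d + 1)).isCompact_biUnion fun k _ => ?_
  refine ((isCompact_stdSimplex ℝ (Fin k)).prod (isCompact_univ_pi fun _ => hA)).image ?_
  fun_prop

/-- Points of the convex hull are approximated by averages with bounded total error. -/
theorem aux_approx {E : Type*} [NormedAddCommGroup E] [NormedSpace ℝ E] (A : Set E) (x : E)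
    (hx : x ∈ convexHull ℝ A) :
    ∃ F : Set E, F.Finite ∧ F ⊆ A ∧ ∃ C : ℝ, ∀ n : ℕ, ∃ l : List E, l.length = n ∧
      (∀ a ∈ l, a ∈ F) ∧ ‖l.sum - (n : ℝ) • x‖ ≤ C := by
  let P : Set E := {x | ∃ F : Set E, F.Finite ∧ F ⊆ A ∧ ∃ C : ℝ, ∀ n : ℕ, ∃ l : List E,
      l.length = n ∧ (∀ a ∈ l, a ∈ F) ∧ ‖l.sum - (n : ℝ) • x‖ ≤ C}
  suffices h : convexHull ℝ A ⊆ P from h hx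
  apply convexHull_min
  · intro a ha
    refine ⟨{a}, Set.finite_singleton a, by simpa using ha, 0, fun n => ⟨List.replicate n a, ?_, ?_, ?_⟩⟩
    · simp
    · intro b hb; simpa using List.eq_of_mem_replicate hb
    · simp [Nat.cast_smul_eq_nsmul]
  · rintro x ⟨F, hF, hFA, C, h⟩ y ⟨G, hG, hGA, D, k⟩ a b ha hb hab
    refine ⟨F ∪ G, hF.union hG, Set.union_subset hFA hGA, C + D + (‖x‖ + ‖y‖), fun n => ?_⟩
    have han : 0 ≤ a * n := by positivity
    have h1 := Nat.floor_le han
    have h2 := Nat.lt_floor_add_one (a * n)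
    set p := ⌊a * n⌋₊
    have hpn : p ≤ n := by
      have : (p : ℝ) ≤ n := h1.trans (by nlinarith [(Nat.cast_nonneg n : (0:ℝ) ≤ n)])
      exact_mod_cast this
    obtain ⟨l, hl, hlF, hle⟩ := h p
    obtain ⟨m, hm, hmG, hme⟩ := k (n - p)
    refine ⟨l ++ m, by simp [hl, hm, hpn], ?_, ?_⟩
    · intro c hc
      rcases List.mem_append.1 hc with hc | hc
      · exact Or.inl (hlF c hc)
      · exact Or.inr (hmG c hc)
    · have hb' : b = 1 - a := by linarith
      have e : (l ++ m).sum - (n : ℝ) • (a • x + b • y) =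
          (l.sum - (p : ℝ) • x) + (m.sum - ((n - p : ℕ) : ℝ) • y) + ((p - a * n) • x + (a * n - p) • y) := by
        rw [Nat.cast_sub hpn, List.sum_append, hb']
        module
      rw [e]
      refine (norm_add_le _ _).trans (add_le_add ((norm_add_le _ _).trans (add_le_add hle hme)) ?_)
      refine (norm_add_le _ _).trans (add_le_add ?_ ?_)
      · rw [norm_smul]
        refine mul_le_of_le_one_left (norm_nonneg _) ?_
        rw [Real.norm_eq_abs, abs_le]; constructor <;> linarith
      · rw [norm_smul]
        refine mul_le_of_le_one_left (norm_nonneg _) ?_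
        rw [Real.norm_eq_abs, abs_le]; constructor <;> linarith

/-- Lower bound for points of the hull. -/
theorem aux_lower (d : ℕ) (f : EuclideanSpace ℝ (Fin d) → ℝ)
    (hrange : ∀ x, 0 ≤ f x ∧ f x ≤ 1)
    (hdiff : ∀ x, f x = 1 → DifferentiableAt ℝ f x)
    (x : EuclideanSpace ℝ (Fin d)) (hx : x ∈ convexHull ℝ {x | f x = 1}) (ε : ℝ) (hε : 0 < ε) :
    ∀ᶠ n : ℕ in atTop, ∃ xs : Fin n → EuclideanSpace ℝ (Fin d),
            (n : ℝ)⁻¹ • (∑ i, xs i) = x ∧ 1 - ε ≤ ∏ i, f (xs i) := by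
  obtain ⟨F, hF, hFA, C, h⟩ := aux_approx _ x hx
  have hC : 0 ≤ C := by
    obtain ⟨l, -, -, h⟩ := h 0
    exact (norm_nonneg _).trans h
  have hη : 0 < ε / (C + 1) := by positivity
  have hloc : ∀ᶠ t : EuclideanSpace ℝ (Fin d) in nhds 0, ∀ a ∈ F, 1 - ε / (C + 1) * ‖t‖ ≤ f (a + t) := by
    rw [eventually_all_finite hF]
    intro a ha
    have ha1 : f a = 1 := hFA ha
    have hmax : IsLocalMax f a := Eventually.of_forall fun y => by rw [ha1]; exact (hrange y).2
    have hd := (hdiff a ha1).hasFDerivAt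
    rw [hmax.fderiv_eq_zero, hasFDerivAt_iff_isLittleO_nhds_zero] at hd
    filter_upwards [hd.def hη] with t ht
    simp only [ha1, ContinuousLinearMap.zero_apply, sub_zero, Real.norm_eq_abs] at ht
    have := (abs_le.1 ht).1
    linarith
  obtain ⟨δ, hδ, hball⟩ := Metric.eventually_nhds_iff.1 hloc
  have hlim : Tendsto (fun n : ℕ => C / (n : ℝ)) atTop (nhds 0) :=
    tendsto_const_div_atTop_nhds_zero_nat C
  have hlim2 : Tendsto (fun n : ℕ => ε / (n : ℝ)) atTop (nhds 0) :=
    tendsto_const_div_atTop_nhds_zero_nat ε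
  filter_upwards [hlim.eventually_lt_const hδ, hlim2.eventually_lt_const one_pos,
    eventually_gt_atTop 0] with n hn1 hn2 hn0
  have hn : (0 : ℝ) < n := by exact_mod_cast hn0
  obtain ⟨l, hl, hlF, hle⟩ := h n
  subst hl
  set n := l.length
  set t := (n : ℝ)⁻¹ • ((n : ℝ) • x - l.sum) with ht
  have htn : ‖t‖ ≤ C / n := by
    rw [ht, norm_smul, norm_sub_rev, norm_inv, Real.norm_natCast, div_eq_inv_mul]
    gcongr
  have hsum : ∑ i : Fin n, l.get i = l.sum := by
    rw [← List.sum_ofFn, List.ofFn_get]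
  refine ⟨fun i => l.get i + t, ?_, ?_⟩
  · rw [Finset.sum_add_distrib, hsum, Finset.sum_const, Finset.card_univ, Fintype.card_fin,
      ← Nat.cast_smul_eq_nsmul ℝ, ht, smul_smul, mul_inv_cancel₀ hn.ne', one_smul,
      add_sub_cancel, smul_smul, inv_mul_cancel₀ hn.ne', one_smul]
  · have hb : ∀ i : Fin n, 1 - ε / n ≤ f (l.get i + t) := by
      intro i
      have h1 := hball (y := t) (by rw [dist_zero_right]; exact htn.trans_lt hn1) (l.get i)
        (hlF _ (List.get_mem l i))
      refine le_trans ?_ h1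
      have : ε / (C + 1) * ‖t‖ ≤ ε / (C + 1) * ((C + 1) / n) := by
        gcongr
        exact htn.trans (by gcongr; linarith)
      have e : ε / (C + 1) * ((C + 1) / n) = ε / n := by field_simp
      linarith
    calc 1 - ε = 1 + (n : ℝ) * (-(ε / n)) := by field_simp; ring
      _ ≤ (1 + -(ε / n)) ^ n := one_add_mul_le_pow (by linarith) n
      _ = ∏ _i : Fin n, (1 - ε / n) := by
        rw [Finset.prod_const, Finset.card_univ, Fintype.card_fin, sub_eq_add_neg]
      _ ≤ _ := Finset.prod_le_prod (fun i _ => by linarith) (fun i _ => hb i)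

/-- Upper bound for points outside the hull. -/
theorem aux_upper (d : ℕ) (f : EuclideanSpace ℝ (Fin d) → ℝ)
    (hrange : ∀ x, 0 ≤ f x ∧ f x ≤ 1)
    (hcont : Continuous f)
    (hdecay : ∀ ε > 0, ∃ R : ℝ, ∀ x, R ≤ ‖x‖ → f x < ε)
    (x : EuclideanSpace ℝ (Fin d)) (hx : x ∉ convexHull ℝ {x | f x = 1}) (ε : ℝ) (hε : 0 < ε) :
    ∀ᶠ n : ℕ in atTop, ∀ xs : Fin n → EuclideanSpace ℝ (Fin d),
            (n : ℝ)⁻¹ • (∑ i, xs i) = x → ∏ i, f (xs i) ≤ ε := by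
  have hA : IsCompact {x | f x = 1} := by
    refine Metric.isCompact_of_isClosed_isBounded (isClosed_eq hcont continuous_const) ?_
    obtain ⟨R, hR⟩ := hdecay 1 one_pos
    refine isBounded_iff_forall_norm_le.2 ⟨R, fun y hy => ?_⟩
    by_contra hlt
    exact (hR y (not_le.1 hlt).le).ne hy
  obtain ⟨g, u, hgu, hux⟩ := geometric_hahn_banach_closed_point (convex_convexHull ℝ _)
    (aux_hull_compact hA).isClosed hx
  obtain ⟨c, hc0, hc1, hc⟩ : ∃ c : ℝ, 0 ≤ c ∧ c < 1 ∧ ∀ y, u ≤ g y → f y ≤ c := by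
    obtain ⟨R, hR⟩ := hdecay (1/2) (by norm_num)
    have hK : IsCompact (Metric.closedBall (0 : EuclideanSpace ℝ (Fin d)) R ∩ {y | u ≤ g y}) :=
      (isCompact_closedBall _ _).inter_right (isClosed_le continuous_const g.continuous)
    rcases Set.eq_empty_or_nonempty
      (Metric.closedBall (0 : EuclideanSpace ℝ (Fin d)) R ∩ {y | u ≤ g y}) with he | hne
    · refine ⟨1/2, by norm_num, by norm_num, fun y hy => (hR y ?_).le⟩
      by_contra hlt
      have : y ∈ Metric.closedBall (0 : EuclideanSpace ℝ (Fin d)) R ∩ {y | u ≤ g y} :=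
        ⟨by simpa using (not_le.1 hlt).le, hy⟩
      rw [he] at this
      exact this
    · obtain ⟨z, hz, hmax⟩ := hK.exists_isMaxOn hne hcont.continuousOn
      refine ⟨max (1/2) (f z), by positivity, max_lt (by norm_num) ?_, fun y hy => ?_⟩
      · refine lt_of_le_of_ne (hrange z).2 fun h => ?_
        exact absurd (hgu z (subset_convexHull ℝ _ h)) (not_lt.2 hz.2)
      · rcases le_total R ‖y‖ with h | h
        · exact (hR y h).le.trans (le_max_left _ _)
        · exact (hmax ⟨by simpa using h, hy⟩ : f y ≤ f z).trans (le_max_right _ _)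
  obtain ⟨k, hk⟩ := exists_pow_lt_of_lt_one hε hc1
  obtain ⟨R, hR⟩ := hdecay ε hε
  -- if `g y - u` is large, so is the norm of `y`
  have hT : ∀ y, ‖g‖ * |R| + |u| < g y - u → R ≤ ‖y‖ := by
    intro y hy
    by_contra hlt
    have h1 : g y ≤ ‖g‖ * ‖y‖ := (le_abs_self _).trans (g.le_opNorm y)
    have h2 : ‖g‖ * ‖y‖ ≤ ‖g‖ * |R| := by
      gcongr
      exact (not_le.1 hlt).le.trans (le_abs_self R)
    have := neg_abs_le u
    linarith
  set T := ‖g‖ * |R| + |u|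
  have hT0 : 0 ≤ T := by positivity
  have hδ : 0 < g x - u := by linarith
  have hlim : Tendsto (fun n : ℕ => (n : ℝ) * (g x - u)) atTop atTop :=
    tendsto_natCast_atTop_atTop.atTop_mul_const hδ
  filter_upwards [hlim.eventually_gt_atTop (k * T), eventually_gt_atTop 0] with n hn hn0 xs hxs
  have hnp : (0 : ℝ) < n := by exact_mod_cast hn0
  set S := Finset.univ.filter fun i => u ≤ g (xs i)
  by_cases hS : k ≤ S.card
  · calc ∏ i, f (xs i) ≤ ∏ i ∈ S, f (xs i) :=
          Finset.prod_le_prod_of_subset_of_le_one (Finset.subset_univ _)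
            (fun i _ => (hrange _).1) (fun i _ _ => (hrange _).2)
      _ ≤ ∏ _i ∈ S, c := Finset.prod_le_prod (fun i _ => (hrange _).1)
            (fun i hi => hc _ (Finset.mem_filter.1 hi).2)
      _ = c ^ S.card := Finset.prod_const c
      _ ≤ c ^ k := pow_le_pow_of_le_one hc0 hc1.le hS
      _ ≤ ε := hk.le
  · obtain ⟨i, hi⟩ : ∃ i, T < g (xs i) - u := by
      by_contra! hcon
      have e : ∑ i, (g (xs i) - u) = n * (g x - u) := by
        rw [Finset.sum_sub_distrib, ← map_sum, Finset.sum_const, Finset.card_univ,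
          Fintype.card_fin, nsmul_eq_mul, ← hxs, map_smul, smul_eq_mul]
        field_simp
      have h1 : ∑ i, (g (xs i) - u) ≤ ∑ i, if u ≤ g (xs i) then T else 0 := by
        refine Finset.sum_le_sum fun i _ => ?_
        split_ifs with h
        · exact hcon i
        · linarith
      rw [← Finset.sum_filter, Finset.sum_const, nsmul_eq_mul] at h1
      have h2 : (S.card : ℝ) * T ≤ k * T := by
        gcongr
        exact (not_le.1 hS).le
      linarith
    calc ∏ i, f (xs i) ≤ ∏ j ∈ {i}, f (xs j) :=
          Finset.prod_le_prod_of_subset_of_le_one (Finset.subset_univ _)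
            (fun i _ => (hrange _).1) (fun i _ _ => (hrange _).2)
      _ = f (xs i) := Finset.prod_singleton _ _
      _ ≤ ε := (hR _ (hT _ hi)).le

open scoped Classical in

/-- Law of large numbers for uncertain variables: the possibility function describing the
sample average converges pointwise to the indicator function of the convex hull of the
set of maximizers of `f`. -/
theorem stmt_1 (d : ℕ) (f : EuclideanSpace ℝ (Fin d) → ℝ)
    (hrange : ∀ x, 0 ≤ f x ∧ f x ≤ 1)
    (hsup : sSup (Set.range f) = 1)
    (hcont : Continuous f)
    (hsmooth : ∀ x ∈ {x | f x = 1}, ∃ U : Set (EuclideanSpace ℝ (Fin d)),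
        IsOpen U ∧ x ∈ U ∧ ContDiffOn ℝ 2 f U)
    (hdecay : Tendsto f (Filter.comap norm Filter.atTop) (nhds 0)) :
    ∀ x : EuclideanSpace ℝ (Fin d),
      Tendsto (fun n : ℕ =>
          sSup {p : ℝ | ∃ xs : Fin n → EuclideanSpace ℝ (Fin d),
            (n : ℝ)⁻¹ • (∑ i, xs i) = x ∧ p = ∏ i, f (xs i)})
        atTop
        (nhds (if x ∈ convexHull ℝ {x | f x = 1} then 1 else 0)) := by
  intro x
  have hle1 : ∀ (n : ℕ) (xs : Fin n → EuclideanSpace ℝ (Fin d)), ∏ i, f (xs i) ≤ 1 :=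
    fun n xs => Finset.prod_le_one (fun i _ => (hrange _).1) (fun i _ => (hrange _).2)
  split_ifs with hx
  · have hdiff : ∀ x, f x = 1 → DifferentiableAt ℝ f x := by
      intro y hy
      obtain ⟨U, hU, hyU, hf⟩ := hsmooth y hy
      exact (hf.contDiffAt (hU.mem_nhds hyU)).differentiableAt (by norm_num)
    rw [Metric.tendsto_atTop']
    intro ε hε
    obtain ⟨N, hN⟩ := eventually_atTop.1 (aux_lower d f hrange hdiff x hx (ε / 2) (by positivity))
    refine ⟨N, fun n hn => ?_⟩
    obtain ⟨xs, h1, h2⟩ := hN n hn.le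
    have hup : sSup {p : ℝ | ∃ xs : Fin n → EuclideanSpace ℝ (Fin d),
            (n : ℝ)⁻¹ • (∑ i, xs i) = x ∧ p = ∏ i, f (xs i)} ≤ 1 :=
      Real.sSup_le (by rintro p ⟨xs, -, rfl⟩; exact hle1 n xs) zero_le_one
    have hlow : ∏ i, f (xs i) ≤ sSup {p : ℝ | ∃ xs : Fin n → EuclideanSpace ℝ (Fin d),
            (n : ℝ)⁻¹ • (∑ i, xs i) = x ∧ p = ∏ i, f (xs i)} :=
      le_csSup ⟨1, by rintro p ⟨xs, -, rfl⟩; exact hle1 n xs⟩ ⟨xs, h1, rfl⟩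
    rw [Real.dist_eq, abs_lt]
    constructor <;> linarith
  · have hdec : ∀ ε > 0, ∃ R : ℝ, ∀ x, R ≤ ‖x‖ → f x < ε := by
      intro ε hε
      have := hdecay.eventually_lt_const hε
      rw [eventually_comap] at this
      obtain ⟨R, hR⟩ := eventually_atTop.1 this
      exact ⟨R, fun y hy => hR _ hy y rfl⟩
    rw [Metric.tendsto_atTop']
    intro ε hε
    obtain ⟨N, hN⟩ := eventually_atTop.1
      (aux_upper d f hrange hcont hdec x hx (ε / 2) (by positivity))
    refine ⟨N, fun n hn => ?_⟩
    have hup : sSup {p : ℝ | ∃ xs : Fin n → EuclideanSpace ℝ (Fin d),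
            (n : ℝ)⁻¹ • (∑ i, xs i) = x ∧ p = ∏ i, f (xs i)} ≤ ε / 2 :=
      Real.sSup_le (by rintro p ⟨xs, h, rfl⟩; exact hN n hn.le xs h) (by positivity)
    have hlow : 0 ≤ sSup {p : ℝ | ∃ xs : Fin n → EuclideanSpace ℝ (Fin d),
            (n : ℝ)⁻¹ • (∑ i, xs i) = x ∧ p = ∏ i, f (xs i)} :=
      Real.sSup_nonneg (by
        rintro p ⟨xs, -, rfl⟩
        exact Finset.prod_nonneg fun i _ => (hrange _).1)
    rw [Real.dist_eq, abs_lt]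
    constructor <;> linarith
end

section
/- Let f : ℝ^d → ℝ satisfy 0 ≤ f ≤ 1, and let a₁, …, a_p ∈ ℝ^d (p ≥ 1) be points with f(aᵢ) = 1 such that f is twice continuously differentiable on an open neighbourhood of each aᵢ. Let y = ∑_{i=1}^p cᵢ aᵢ with cᵢ > 0 and ∑_{i=1}^p cᵢ = 1. Then lim_{n→∞} sup { ∏_{i=1}^n f(xᵢ) : x₁, …, xₙ ∈ ℝ^d, (x₁ + ⋯ + xₙ)/n = y } = 1. -/
open Real Finset Filter

lemma aux_quad {d : ℕ} (f : EuclideanSpace ℝ (Fin d) → ℝ)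
    (hrange : ∀ x, 0 ≤ f x ∧ f x ≤ 1) (a : EuclideanSpace ℝ (Fin d)) (ha : f a = 1)
    (hs : ∃ U : Set (EuclideanSpace ℝ (Fin d)), IsOpen U ∧ a ∈ U ∧ ContDiffOn ℝ 2 f U) :
    ∃ K : ℝ, 0 ≤ K ∧ ∃ δ : ℝ, 0 < δ ∧ ∀ h, ‖h‖ < δ → 1 - K * ‖h‖ ^ 2 ≤ f (a + h) := by
  obtain ⟨U, hU, haU, hf⟩ := hs
  have hfa : ContDiffAt ℝ 2 f a := hf.contDiffAt (hU.mem_nhds haU)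
  have hd : ContDiffAt ℝ 1 (fderiv ℝ f) a := hfa.fderiv_right (by norm_num)
  obtain ⟨K, t, ht, hL⟩ := hd.exists_lipschitzOnWith
  have h0 : fderiv ℝ f a = 0 := by
    apply IsLocalMax.fderiv_eq_zero
    exact Filter.Eventually.of_forall fun x => by rw [ha]; exact (hrange x).2
  obtain ⟨δ, hδ, hb⟩ := Metric.mem_nhds_iff.1 (Filter.inter_mem ht (hU.mem_nhds haU))
  refine ⟨K, K.2, δ, hδ, fun h hh => ?_⟩
  have hsub : Metric.closedBall a ‖h‖ ⊆ t ∩ U :=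
    (Metric.closedBall_subset_ball hh).trans hb
  have key := (convex_closedBall a ‖h‖).norm_image_sub_le_of_norm_fderiv_le (𝕜 := ℝ) (f := f)
    (C := K * ‖h‖) (x := a) (y := a + h)
    (fun x hx => ((hf.contDiffAt (hU.mem_nhds (hsub hx).2)).differentiableAt (by norm_num)))
    (fun x hx => by
      have h1 := hL.dist_le_mul x (hsub hx).1 a (mem_of_mem_nhds ht)
      rw [h0, dist_zero_right] at h1
      exact h1.trans (mul_le_mul_of_nonneg_left (Metric.mem_closedBall.1 hx) K.2))
    (Metric.mem_closedBall_self (norm_nonneg _)) (by simp)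
  rw [ha, Real.norm_eq_abs, add_sub_cancel_left] at key
  have := (abs_le.1 key).1
  nlinarith

lemma aux_count {p : ℕ} (n : ℕ) (m : Fin p → ℕ) (hm : ∑ i, m i = n) :
    ∃ σ : Fin n → Fin p, ∀ {E : Type} [AddCommMonoid E] (g : Fin p → E),
      ∑ j, g (σ j) = ∑ i, m i • g i := by
  have e : Fin n ≃ (Σ i : Fin p, Fin (m i)) :=
    Fintype.equivOfCardEq (by simp [hm])
  refine ⟨fun j => (e j).1, fun g => ?_⟩
  rw [e.sum_comp (fun s => g s.1), Fintype.sum_sigma]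
  simp

lemma aux_approx_s2 {d p : ℕ} (hp : 1 ≤ p) (a : Fin p → EuclideanSpace ℝ (Fin d))
    (c : Fin p → ℝ) (hc : ∀ i, 0 < c i) (hcsum : ∑ i, c i = 1) :
    ∃ B : ℝ, 0 ≤ B ∧ ∀ n : ℕ, ∃ σ : Fin n → Fin p,
      ‖(n : ℝ) • (∑ i, c i • a i) - ∑ j, a (σ j)‖ ≤ B := by
  refine ⟨∑ i, (p + 1 : ℝ) * ‖a i‖, by positivity, fun n => ?_⟩
  have hfl : ∀ i, (⌊(n : ℝ) * c i⌋₊ : ℝ) ≤ n * c i := fun i =>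
    Nat.floor_le (mul_nonneg (Nat.cast_nonneg _) (hc i).le)
  have hfl2 : ∀ i, (n : ℝ) * c i ≤ ⌊(n : ℝ) * c i⌋₊ + 1 := fun i => (Nat.lt_floor_add_one _).le
  have hs : ∑ i, (n : ℝ) * c i = n := by rw [← Finset.mul_sum, hcsum, mul_one]
  have hle : ∑ i, ⌊(n : ℝ) * c i⌋₊ ≤ n := by
    have : (∑ i, (⌊(n : ℝ) * c i⌋₊ : ℝ)) ≤ n :=
      (Finset.sum_le_sum fun i _ => hfl i).trans hs.le
    exact_mod_cast this
  obtain ⟨r, hr⟩ := Nat.exists_eq_add_of_le hle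
  have hrp : (r : ℝ) ≤ p := by
    have h1 : (n : ℝ) ≤ ∑ i, ((⌊(n : ℝ) * c i⌋₊ : ℝ) + 1) := by
      conv_lhs => rw [← hs]
      exact Finset.sum_le_sum fun i _ => hfl2 i
    have h2 : (n : ℝ) = (∑ i, (⌊(n : ℝ) * c i⌋₊ : ℝ)) + r := by exact_mod_cast hr
    rw [Finset.sum_add_distrib] at h1
    simp at h1
    linarith
  let i0 : Fin p := ⟨0, hp⟩
  obtain ⟨σ, hσ⟩ := aux_count n (fun i => ⌊(n : ℝ) * c i⌋₊ + if i = i0 then r else 0) (by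
    rw [Finset.sum_add_distrib]; simp; exact hr.symm)
  refine ⟨σ, ?_⟩
  rw [hσ, Finset.smul_sum, ← Finset.sum_sub_distrib]
  refine norm_sum_le_of_le _ fun i _ => ?_
  rw [← Nat.cast_smul_eq_nsmul ℝ, smul_smul, ← sub_smul, norm_smul]
  refine mul_le_mul_of_nonneg_right ?_ (norm_nonneg _)
  have := hfl i
  have := hfl2 i
  have : (0 : ℝ) ≤ r := Nat.cast_nonneg _
  rw [Real.norm_eq_abs, abs_le]
  split_ifs <;> push_cast <;> constructor <;> linarith

/-- Part of the LLN for uncertain variables: convergence to `1` at any convex combination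
of maximizers of `f`. -/
theorem stmt_2 (d p : ℕ) (hp : 1 ≤ p) (f : EuclideanSpace ℝ (Fin d) → ℝ)
    (hrange : ∀ x, 0 ≤ f x ∧ f x ≤ 1)
    (a : Fin p → EuclideanSpace ℝ (Fin d)) (ha : ∀ i, f (a i) = 1)
    (hsmooth : ∀ i, ∃ U : Set (EuclideanSpace ℝ (Fin d)),
        IsOpen U ∧ a i ∈ U ∧ ContDiffOn ℝ 2 f U)
    (c : Fin p → ℝ) (hc : ∀ i, 0 < c i) (hcsum : ∑ i, c i = 1)
    (y : EuclideanSpace ℝ (Fin d)) (hy : y = ∑ i, c i • a i) :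
    Tendsto (fun n : ℕ =>
        sSup {q : ℝ | ∃ xs : Fin n → EuclideanSpace ℝ (Fin d),
          (n : ℝ)⁻¹ • (∑ i, xs i) = y ∧ q = ∏ i, f (xs i)}) atTop (nhds 1) := by
  obtain ⟨B, hB, hσ⟩ := aux_approx_s2 hp a c hc hcsum
  choose K hK δ hδ hq using fun i => aux_quad f hrange (a i) (ha i) (hsmooth i)
  let M : ℝ := ∑ i, K i
  have hKM : ∀ i, K i ≤ M := fun i =>
    Finset.single_le_sum (f := K) (fun j _ => hK j) (Finset.mem_univ i)
  have hM : 0 ≤ M := Finset.sum_nonneg fun j _ => hK j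
  have hlim : ∀ C : ℝ, Tendsto (fun n : ℕ => C / (n : ℝ)) atTop (nhds 0) := fun C =>
    tendsto_const_div_atTop_nhds_zero_nat C
  have hlow : Tendsto (fun n : ℕ => 1 - (M * B ^ 2) / (n : ℝ)) atTop (nhds 1) := by
    simpa using (hlim (M * B ^ 2)).const_sub 1
  have hub : ∀ n : ℕ, ∀ q ∈ {q : ℝ | ∃ xs : Fin n → EuclideanSpace ℝ (Fin d),
      (n : ℝ)⁻¹ • (∑ i, xs i) = y ∧ q = ∏ i, f (xs i)}, q ≤ 1 := by
    rintro n q ⟨xs, -, rfl⟩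
    exact Finset.prod_le_one (fun i _ => (hrange _).1) (fun i _ => (hrange _).2)
  refine tendsto_of_tendsto_of_tendsto_of_le_of_le' hlow tendsto_const_nhds ?_
    (Filter.Eventually.of_forall fun n => Real.sSup_le (hub n) zero_le_one)
  have hev : ∀ᶠ n : ℕ in atTop, ∀ i, B / (n : ℝ) < δ i :=
    Filter.eventually_all.2 fun i => (hlim B).eventually_lt_const (hδ i)
  have hev2 : ∀ᶠ n : ℕ in atTop, (M * B ^ 2) / (n : ℝ) < 1 :=
    (hlim _).eventually_lt_const one_pos
  filter_upwards [hev, hev2, Filter.eventually_ge_atTop 1] with n h1 h2 hn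
  obtain ⟨σ, hs⟩ := hσ n
  rw [← hy] at hs
  have hn1 : (1 : ℝ) ≤ n := by exact_mod_cast hn
  have hn0 : (0 : ℝ) < n := by linarith
  set e := (n : ℝ) • y - ∑ j, a (σ j) with he
  have hnorm : ‖(n : ℝ)⁻¹ • e‖ ≤ B / n := by
    rw [norm_smul, norm_inv, Real.norm_natCast, div_eq_inv_mul]
    exact mul_le_mul_of_nonneg_left hs (by positivity)
  refine le_trans ?_ (le_csSup ⟨1, hub n⟩ ⟨fun j => a (σ j) + (n : ℝ)⁻¹ • e, ?_, rfl⟩)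
  · have ht : (M * B ^ 2) / (n : ℝ) = n * (M * (B / n) ^ 2) := by field_simp
    have ht0 : 0 ≤ M * (B / n) ^ 2 := by positivity
    have ht1 : M * (B / n) ^ 2 ≤ 1 := by nlinarith
    have hp1 := one_add_mul_le_pow (a := -(M * (B / n) ^ 2)) (by linarith) n
    have hp2 : ∏ _j : Fin n, (1 - M * (B / n) ^ 2) ≤ ∏ j, f (a (σ j) + (n : ℝ)⁻¹ • e) := by
      refine Finset.prod_le_prod (fun _ _ => by linarith) fun j _ => ?_
      refine le_trans ?_ (hq (σ j) _ (hnorm.trans_lt (h1 _)))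
      have : K (σ j) * ‖(n : ℝ)⁻¹ • e‖ ^ 2 ≤ M * (B / n) ^ 2 := by
        gcongr
        exact hKM _
      linarith
    rw [Finset.prod_const, Finset.card_univ, Fintype.card_fin] at hp2
    rw [ht]
    rw [← sub_eq_add_neg] at hp1
    linarith
  · rw [Finset.sum_add_distrib, Finset.sum_const, Finset.card_univ, Fintype.card_fin,
      ← Nat.cast_smul_eq_nsmul ℝ, smul_smul, mul_inv_cancel₀ hn0.ne', one_smul, he,
      add_sub_cancel, smul_smul, inv_mul_cancel₀ hn0.ne', one_smul]
end

section
/- Let f : ℝ^d → [0,1] be continuous with sup_{x} f(x) = 1 and f(x) → 0 as ‖x‖ → ∞, and set A = {x : f(x) = 1} (which is nonempty and compact). If y ∈ ℝ^d has positive distance from the convex hull of A, then lim_{n→∞} sup { ∏_{i=1}^n f(xᵢ) : x₁, …, xₙ ∈ ℝ^d, (x₁ + ⋯ + xₙ)/n = y } = 0. -/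
open Real Finset Filter

/-- Part of the LLN for uncertain variables: convergence to `0` at any point with positive
distance from the convex hull of the maximizers of `f`. -/
theorem stmt_3 (d : ℕ) (f : EuclideanSpace ℝ (Fin d) → ℝ)
    (hrange : ∀ x, 0 ≤ f x ∧ f x ≤ 1)
    (hsup : sSup (Set.range f) = 1)
    (hcont : Continuous f)
    (hdecay : Tendsto f (Filter.comap norm Filter.atTop) (nhds 0))
    (y : EuclideanSpace ℝ (Fin d))
    (hy : 0 < Metric.infDist y (convexHull ℝ {x | f x = 1})) :
    Tendsto (fun n : ℕ =>
        sSup {q : ℝ | ∃ xs : Fin n → EuclideanSpace ℝ (Fin d),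
          (n : ℝ)⁻¹ • (∑ i, xs i) = y ∧ q = ∏ i, f (xs i)}) atTop (nhds 0) := by
  have hdec : ∀ ε > 0, ∃ R : ℝ, ∀ x, R ≤ ‖x‖ → f x < ε := by
    intro ε hε
    have h := hdecay.eventually (gt_mem_nhds hε)
    rw [Filter.eventually_comap, Filter.eventually_atTop] at h
    obtain ⟨R, hR⟩ := h
    exact ⟨R, fun x hx => hR _ hx x rfl⟩
  have hycl : y ∉ closure (convexHull ℝ {x | f x = 1}) := fun h =>
    hy.ne' (Metric.infDist_zero_of_mem_closure h)
  obtain ⟨g, u, hg, hu⟩ := geometric_hahn_banach_closed_point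
    (convex_convexHull ℝ {x | f x = 1}).closure isClosed_closure hycl
  have hA : ∀ x, u ≤ g x → f x < 1 := by
    intro x hx
    refine lt_of_le_of_ne (hrange x).2 fun h => ?_
    exact absurd (hg x (subset_closure (subset_convexHull ℝ _ h))) (not_lt.2 hx)
  obtain ⟨ρ, hρ0, hρ1, hρ⟩ : ∃ ρ : ℝ, 0 ≤ ρ ∧ ρ < 1 ∧ ∀ x, u ≤ g x → f x ≤ ρ := by
    obtain ⟨R, hR⟩ := hdec (1/2) (by norm_num)
    have hK : IsCompact (Metric.closedBall (0 : EuclideanSpace ℝ (Fin d)) R ∩ {x | u ≤ g x}) :=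
      (isCompact_closedBall _ _).inter_right (isClosed_le continuous_const g.continuous)
    rcases (Metric.closedBall (0 : EuclideanSpace ℝ (Fin d)) R ∩ {x | u ≤ g x}).eq_empty_or_nonempty
      with he | hne
    · refine ⟨1/2, by norm_num, by norm_num, fun x hx => ?_⟩
      rcases le_total R ‖x‖ with h | h
      · exact (hR x h).le
      · exact absurd ⟨by simpa using h, hx⟩ (Set.eq_empty_iff_forall_notMem.1 he x)
    · obtain ⟨z, hz, hmax⟩ := hK.exists_isMaxOn hne hcont.continuousOn
      refine ⟨max (1/2) (f z), by positivity, max_lt (by norm_num) (hA z hz.2), fun x hx => ?_⟩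
      rcases le_total R ‖x‖ with h | h
      · exact (hR x h).le.trans (le_max_left _ _)
      · exact le_trans (hmax (show x ∈ _ from ⟨by simpa using h, hx⟩)) (le_max_right _ _)
  rw [Metric.tendsto_atTop]
  intro ε hε
  obtain ⟨R, hR⟩ := hdec (ε/2) (by positivity)
  obtain ⟨K, hK⟩ := exists_pow_lt_of_lt_one (half_pos hε) hρ1
  -- if `g x` is large then `‖x‖` is large
  have hlin : ∀ x, ‖g‖ * |R| + 1 ≤ g x → f x < ε/2 := by
    intro x hx
    apply hR
    by_contra! hlt
    have h1 : g x ≤ ‖g‖ * ‖x‖ := (le_abs_self _).trans (g.le_opNorm x)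
    have h2 : ‖g‖ * ‖x‖ ≤ ‖g‖ * |R| := by
      gcongr
      exact hlt.le.trans (le_abs_self R)
    linarith
  set M : ℝ := |‖g‖ * |R| + 1 - u| + 1 with hM
  have hMpos : 0 < M := by positivity
  obtain ⟨N, hN⟩ := exists_nat_gt (K * M / (g y - u))
  refine ⟨N + 1, fun n hn => ?_⟩
  have hgy : 0 < g y - u := by linarith
  have hnpos : (0:ℝ) < n := by exact_mod_cast (by omega : 0 < n)
  have hbig : K * M < n * (g y - u) := by
    have h1 : (N : ℝ) ≤ n := by exact_mod_cast (by omega : N ≤ n)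
    have := (div_lt_iff₀ hgy).1 (hN.trans_le h1)
    exact this
  rw [Real.dist_eq, sub_zero, abs_of_nonneg]
  swap
  · apply Real.sSup_nonneg
    rintro q ⟨xs, -, rfl⟩
    exact Finset.prod_nonneg fun i _ => (hrange _).1
  refine lt_of_le_of_lt (Real.sSup_le ?_ (half_pos hε).le) (half_lt_self hε)
  rintro q ⟨xs, hxs, rfl⟩
  have hsum : ∑ i, (g (xs i) - u) = n * (g y - u) := by
    rw [← hxs]
    simp only [Finset.sum_sub_distrib, map_smul, map_sum, smul_eq_mul, Finset.sum_const,
      Finset.card_univ, Fintype.card_fin, nsmul_eq_mul]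
    field_simp
  classical
  set T : Finset (Fin n) := Finset.univ.filter fun i => u ≤ g (xs i) with hT
  have hsub : ∀ S : Finset (Fin n), ∏ i, f (xs i) ≤ ∏ i ∈ S, f (xs i) := by
    intro S
    rw [← Finset.prod_mul_prod_compl S]
    exact mul_le_of_le_one_right (Finset.prod_nonneg fun i _ => (hrange _).1)
      (Finset.prod_le_one (fun i _ => (hrange _).1) fun i _ => (hrange _).2)
  rcases le_or_gt K T.card with hc | hc
  · calc ∏ i, f (xs i) ≤ ∏ i ∈ T, f (xs i) := hsub T
      _ ≤ ∏ i ∈ T, ρ := Finset.prod_le_prod (fun i _ => (hrange _).1) fun i hi =>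
          hρ _ (Finset.mem_filter.1 hi).2
      _ = ρ ^ T.card := by simp
      _ ≤ ρ ^ K := pow_le_pow_of_le_one hρ0 hρ1.le hc
      _ ≤ ε/2 := hK.le
  · obtain ⟨i, hi⟩ : ∃ i, M ≤ g (xs i) - u := by
      by_contra! hcon
      have h1 : ∑ i, (g (xs i) - u) ≤ ∑ i ∈ T, (g (xs i) - u) := by
        rw [hT, Finset.sum_filter]
        refine Finset.sum_le_sum fun i _ => ?_
        split_ifs with h
        · exact le_rfl
        · linarith
      have h2 : ∑ i ∈ T, (g (xs i) - u) ≤ T.card * M := by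
        rw [← nsmul_eq_mul]
        exact Finset.sum_le_card_nsmul _ _ _ fun i _ => (hcon i).le
      have h3 : (T.card : ℝ) * M ≤ K * M := by
        gcongr
      linarith
    have h1 := hsub {i}
    rw [Finset.prod_singleton] at h1
    refine h1.trans (hlin _ ?_).le
    have := le_abs_self (‖g‖ * |R| + 1 - u)
    linarith
end

section
/- Let C ⊆ ℝ^d be a nonempty closed convex set, let n ≥ 1, let x₁, …, xₙ ∈ ℝ^d, and let δ > 0 be such that the distance from the mean (x₁ + ⋯ + xₙ)/n to C is at least δ. Suppose there is a subset S ⊆ {1, …, n} of cardinality k such that dist(xᵢ, C) ≤ δ(1 + √n) for every i ∈ S and dist(xᵢ, C) ≤ δ/2 for every i ∉ S. Then k ≥ n/(1 + 2√n). -/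
open Real Finset

/-- Counting estimate: if the mean of `x₁, …, xₙ` is at distance at least `δ` from the
nonempty closed convex set `C`, points indexed by `S` are within distance `δ(1 + √n)` of
`C` and the remaining points are within distance `δ/2` of `C`, then `|S| ≥ n/(1 + 2√n)`. -/
theorem stmt_4 (d : ℕ) (C : Set (EuclideanSpace ℝ (Fin d)))
    (hCne : C.Nonempty) (hCclosed : IsClosed C) (hCconvex : Convex ℝ C)
    (n : ℕ) (hn : 1 ≤ n) (x : Fin n → EuclideanSpace ℝ (Fin d))
    (δ : ℝ) (hδ : 0 < δ)
    (hmean : δ ≤ Metric.infDist ((n : ℝ)⁻¹ • ∑ i, x i) C)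
    (S : Finset (Fin n)) (k : ℕ) (hk : S.card = k)
    (hS : ∀ i ∈ S, Metric.infDist (x i) C ≤ δ * (1 + Real.sqrt n))
    (hSc : ∀ i ∉ S, Metric.infDist (x i) C ≤ δ / 2) :
    (n : ℝ) / (1 + 2 * Real.sqrt n) ≤ k := by
  have hn0 : (0 : ℝ) < n := by exact_mod_cast hn
  choose y hyC hy using fun i => hCclosed.exists_infDist_eq_dist hCne (x i)
  have hmem : (n : ℝ)⁻¹ • ∑ i, y i ∈ C := by
    rw [Finset.smul_sum]
    refine hCconvex.sum_mem (fun _ _ => by positivity) ?_ (fun i _ => hyC i)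
    simp [hn0.ne']
  have h1 : δ ≤ (n : ℝ)⁻¹ * ∑ i, Metric.infDist (x i) C := by
    refine (hmean.trans (Metric.infDist_le_dist_of_mem hmem)).trans ?_
    rw [dist_eq_norm, ← smul_sub, ← Finset.sum_sub_distrib, norm_smul, Real.norm_of_nonneg
      (by positivity)]
    refine mul_le_mul_of_nonneg_left ((norm_sum_le _ _).trans (le_of_eq ?_)) (by positivity)
    exact Finset.sum_congr rfl fun i _ => by rw [hy i, dist_eq_norm]
  have h2 : ∑ i, Metric.infDist (x i) C
      ≤ ∑ i, (δ / 2 + if i ∈ S then δ * (1 / 2 + Real.sqrt n) else 0) := by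
    refine Finset.sum_le_sum fun i _ => ?_
    split_ifs with h
    · linarith [hS i h]
    · linarith [hSc i h]
  have h3 : ∑ i, (δ / 2 + if i ∈ S then δ * (1 / 2 + Real.sqrt n) else 0)
      = n * (δ / 2) + k * (δ * (1 / 2 + Real.sqrt n)) := by
    rw [Finset.sum_add_distrib]
    simp [hk]
  have h4 : n * δ ≤ n * (δ / 2) + k * (δ * (1 / 2 + Real.sqrt n)) := by
    rw [← h3]
    refine le_trans ?_ h2
    rwa [inv_mul_eq_div, le_div_iff₀ hn0, mul_comm] at h1
  rw [div_le_iff₀ (by positivity)]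
  refine le_of_mul_le_mul_left ?_ hδ
  linarith
end

section
/- Let f : ℝ → ℝ be a positive, twice differentiable function with log f strictly concave, such that sup_{x ∈ ℝ} f(x) = 1 and the supremum is attained; let μ be the unique point with f(μ) = 1. For n ≥ 1 and t ∈ ℝ define f_{t_n}(t) = sup { ∏_{i=1}^n f(xᵢ) : x₁, …, xₙ ∈ ℝ, n^{-1/2} ∑_{i=1}^n (xᵢ − μ) = t }. Then for every t ∈ ℝ, lim_{n→∞} f_{t_n}(t) = exp( f''(μ) t² / 2 ); in particular the limit equals the normal possibility function N̄(t; 0, σ²) = exp(−t²/(2σ²)) with 1/σ² = −f''(μ) when f''(μ) ≠ 0, and equals 1 when f''(μ) = 0. -/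
open Real Finset Filter

lemma taylor_aux (f : ℝ → ℝ) 
    (hdiff : ∀ x, DifferentiableAt ℝ f x)
    (hdiff2 : ∀ x, DifferentiableAt ℝ (deriv f) x)
    (hle : ∀ x, f x ≤ 1) (μ : ℝ) (hμ : f μ = 1) :
    Tendsto (fun x => (f x - 1) / (x - μ) ^ 2) (nhdsWithin μ {μ}ᶜ)
      (nhds (deriv (deriv f) μ / 2)) := by
  have h0 : deriv f μ = 0 := by
    apply IsLocalMax.deriv_eq_zero
    exact Eventually.of_forall fun x => by rw [hμ]; exact hle x
  have hs := hasDerivAt_iff_tendsto_slope.1 (hdiff2 μ).hasDerivAt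
  refine HasDerivAt.lhopital_zero_nhdsNE (f' := deriv f) (g' := fun x => 2 * (x - μ)) ?_ ?_ ?_ ?_ ?_ ?_
  · exact Eventually.of_forall fun x => (hdiff x).hasDerivAt.sub_const 1
  · refine Eventually.of_forall fun x => ?_
    have h := ((hasDerivAt_id x).sub_const μ).pow 2
    have e : ((2:ℕ):ℝ) * (id x - μ) ^ (2 - 1) * 1 = 2 * (x - μ) := by simp
    rw [e] at h
    exact h
  · filter_upwards [self_mem_nhdsWithin] with x hx
    exact mul_ne_zero two_ne_zero (sub_ne_zero.2 hx)
  · have := ((hdiff μ).continuousAt.sub_const 1 : Tendsto _ _ _)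
    simp only [hμ, sub_self] at this
    exact this.mono_left nhdsWithin_le_nhds
  · have : ContinuousAt (fun x : ℝ => (x - μ) ^ 2) μ := by fun_prop
    have := this.tendsto
    simp only [sub_self, ne_eq, OfNat.ofNat_ne_zero, not_false_eq_true, zero_pow] at this
    exact this.mono_left nhdsWithin_le_nhds
  · refine (hs.div_const 2).congr fun x => ?_
    rw [slope_def_field, h0, sub_zero, div_div, mul_comm]

lemma sSup_aux (f : ℝ → ℝ) (hpos : ∀ x, 0 < f x)
    (hconc : ConcaveOn ℝ Set.univ (fun x => Real.log (f x))) (μ t : ℝ) (n : ℕ) (hn : 0 < n) :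
    sSup {q : ℝ | ∃ xs : Fin n → ℝ,
          (∑ i, (xs i - μ)) / Real.sqrt n = t ∧ q = ∏ i, f (xs i)} = f (μ + t / √n) ^ n := by
  have hn' : (0:ℝ) < n := by exact_mod_cast hn
  have hs : 0 < √(n:ℝ) := Real.sqrt_pos.2 hn'
  have hss : √(n:ℝ) * √(n:ℝ) = n := Real.mul_self_sqrt hn'.le
  apply IsGreatest.csSup_eq
  constructor
  · refine ⟨fun _ => μ + t / √n, ?_, by simp⟩
    simp only [add_sub_cancel_left, sum_const, card_univ, Fintype.card_fin, nsmul_eq_mul]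
    rw [div_eq_iff hs.ne', mul_div_assoc', div_eq_iff hs.ne', mul_assoc, hss, mul_comm]
  · rintro q ⟨xs, h, rfl⟩
    rw [← Real.log_le_log_iff (prod_pos fun i _ => hpos _) (pow_pos (hpos _) _),
      Real.log_prod (fun i _ => (hpos _).ne'), Real.log_pow]
    have := hconc.le_map_sum (t := Finset.univ) (w := fun _ : Fin n => 1 / (n:ℝ)) (p := xs)
      (fun _ _ => by positivity) (by simp [hn'.ne']) (fun _ _ => Set.mem_univ _)
    simp only [smul_eq_mul, ← Finset.mul_sum] at this
    have e : 1 / (n:ℝ) * ∑ i, xs i = μ + t / √n := by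
      rw [sum_sub_distrib, div_eq_iff hs.ne'] at h
      simp only [sum_const, card_univ, Fintype.card_fin, nsmul_eq_mul] at h
      have h2 : ∑ i, xs i = n * μ + t * √n := by linarith
      rw [h2, one_div, inv_mul_eq_iff_eq_mul₀ hn'.ne', mul_add, mul_div_assoc', add_right_inj,
        eq_div_iff hs.ne', mul_assoc, hss, mul_comm]
    rw [e, one_div, inv_mul_le_iff₀ hn'] at this
    exact this

/-- Central limit theorem for uncertain variables: the possibility function describing the
centred and scaled sum converges pointwise to `exp(f''(μ) t² / 2)`, i.e. to the normal
possibility function `N̄(0, σ²)` with `1/σ² = −f''(μ)` when `f''(μ) ≠ 0`, and to `1`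
when `f''(μ) = 0`. -/
theorem stmt_5 (f : ℝ → ℝ) (hpos : ∀ x, 0 < f x)
    (hdiff : ∀ x, DifferentiableAt ℝ f x)
    (hdiff2 : ∀ x, DifferentiableAt ℝ (deriv f) x)
    (hconc : StrictConcaveOn ℝ Set.univ (fun x => Real.log (f x)))
    (hle : ∀ x, f x ≤ 1) (μ : ℝ) (hμ : f μ = 1) :
    ∀ t : ℝ, Tendsto (fun n : ℕ =>
        sSup {q : ℝ | ∃ xs : Fin n → ℝ,
          (∑ i, (xs i - μ)) / Real.sqrt n = t ∧ q = ∏ i, f (xs i)})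
      atTop (nhds (Real.exp (deriv (deriv f) μ * t ^ 2 / 2))) := by
  intro t
  have key : Tendsto (fun n : ℕ => (1 + (f (μ + t / √n) - 1)) ^ n) atTop
      (nhds (Real.exp (deriv (deriv f) μ * t ^ 2 / 2))) := by
    apply Real.tendsto_one_add_pow_exp_of_tendsto
    rcases eq_or_ne t 0 with rfl | ht
    · simp [hμ]
    have hx : Tendsto (fun n : ℕ => μ + t / √(n:ℝ)) atTop (nhdsWithin μ {μ}ᶜ) := by
      refine tendsto_nhdsWithin_iff.2 ⟨?_, ?_⟩
      · have := (Real.tendsto_sqrt_atTop.comp tendsto_natCast_atTop_atTop).const_div_atTop t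
        simpa using this.const_add μ
      · filter_upwards [eventually_gt_atTop 0] with n hn
        have hs : 0 < √(n:ℝ) := Real.sqrt_pos.2 (by exact_mod_cast hn)
        have : t / √(n:ℝ) ≠ 0 := div_ne_zero ht hs.ne'
        simpa using this
    have h := ((taylor_aux f hdiff hdiff2 hle μ hμ).comp hx).mul_const (t ^ 2)
    rw [show deriv (deriv f) μ * t ^ 2 / 2 = deriv (deriv f) μ / 2 * t ^ 2 by ring]
    refine h.congr' ?_
    filter_upwards [eventually_gt_atTop 0] with n hn
    have hn' : (0:ℝ) < n := by exact_mod_cast hn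
    simp only [Function.comp, add_sub_cancel_left, div_pow, Real.sq_sqrt hn'.le]
    field_simp
  refine key.congr' ?_
  filter_upwards [eventually_gt_atTop 0] with n hn
  rw [sSup_aux f hpos hconc.concaveOn μ t n hn, add_sub_cancel]
end

section
/- Let μ ∈ ℝ and let f : ℝ → ℝ be differentiable on a neighbourhood of μ and twice differentiable at μ, with f(μ) = 1 and f'(μ) = 0. Then for every t ∈ ℝ, lim_{n→∞} f(μ + t/√n)^n = exp( f''(μ) t² / 2 ). -/
open Real Filter

/-- Analytic step in the CLT for uncertain variables: if `f` is differentiable near `μ`,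
twice differentiable at `μ`, with `f(μ) = 1` and `f'(μ) = 0`, then
`f(μ + t/√n)ⁿ → exp(f''(μ) t²/2)`. -/
theorem stmt_7 (f : ℝ → ℝ) (μ : ℝ)
    (hdiff : ∀ᶠ x in nhds μ, DifferentiableAt ℝ f x)
    (hdiff2 : DifferentiableAt ℝ (deriv f) μ)
    (hfμ : f μ = 1) (hf'μ : deriv f μ = 0) :
    ∀ t : ℝ, Tendsto (fun n : ℕ => f (μ + t / Real.sqrt n) ^ n) atTop
      (nhds (Real.exp (deriv (deriv f) μ * t ^ 2 / 2))) := by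
  intro t
  have key : Tendsto (fun x => (f x - 1) / (x - μ) ^ 2) (nhdsWithin μ {μ}ᶜ)
      (nhds (deriv (deriv f) μ / 2)) := by
    have hc : ContinuousAt f μ := hdiff.self_of_nhds.continuousAt
    refine HasDerivAt.lhopital_zero_nhdsNE (f' := deriv f) (g' := fun x => 2 * (x - μ))
      ?_ ?_ ?_ ?_ ?_ ?_
    · filter_upwards [hdiff.filter_mono nhdsWithin_le_nhds] with x hx
      exact hx.hasDerivAt.sub_const 1
    · refine Eventually.of_forall fun x => ?_
      have h := ((hasDerivAt_id x).sub_const μ).fun_pow 2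
      simpa using h
    · filter_upwards [self_mem_nhdsWithin] with x hx
      have : x - μ ≠ 0 := sub_ne_zero.mpr hx
      positivity
    · have h : Tendsto (fun x => f x - 1) (nhds μ) (nhds (f μ - 1)) := hc.tendsto.sub_const 1
      rw [hfμ, sub_self] at h
      exact h.mono_left nhdsWithin_le_nhds
    · have h : Tendsto (fun x : ℝ => (x - μ) ^ 2) (nhds μ) (nhds ((μ - μ) ^ 2)) :=
        Continuous.tendsto (by fun_prop) μ
      rw [sub_self, zero_pow two_ne_zero] at h
      exact h.mono_left nhdsWithin_le_nhds
    · have h := (hasDerivAt_iff_tendsto_slope.mp hdiff2.hasDerivAt).div_const 2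
      refine h.congr fun x => ?_
      rw [slope_def_field, hf'μ, sub_zero, div_div, mul_comm]
  by_cases ht : t = 0
  · subst ht
    simp [hfμ]
  have hseq : Tendsto (fun n : ℕ => μ + t / Real.sqrt n) atTop (nhdsWithin μ {μ}ᶜ) := by
    refine tendsto_nhdsWithin_iff.mpr ⟨?_, ?_⟩
    · have h : Tendsto (fun n : ℕ => t / Real.sqrt n) atTop (nhds 0) :=
        (Real.tendsto_sqrt_atTop.comp tendsto_natCast_atTop_atTop).const_div_atTop t
      simpa using h.const_add μ
    · filter_upwards [eventually_gt_atTop 0] with n hn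
      have h : Real.sqrt n ≠ 0 := by positivity
      simp [ht, hn.ne']
  have hmain : Tendsto (fun n : ℕ => (n : ℝ) * (f (μ + t / Real.sqrt n) - 1)) atTop
      (nhds (deriv (deriv f) μ * t ^ 2 / 2)) := by
    have h := (key.comp hseq).mul_const (t ^ 2)
    rw [div_mul_eq_mul_div] at h
    refine h.congr' ?_
    filter_upwards [eventually_gt_atTop 0] with n hn
    have hn' : (n : ℝ) ≠ 0 := by positivity
    have hs : Real.sqrt n ^ 2 = n := Real.sq_sqrt (Nat.cast_nonneg n)
    simp only [Function.comp, add_sub_cancel_left, div_pow, hs]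
    field_simp
  refine (Real.tendsto_one_add_pow_exp_of_tendsto hmain).congr fun n => ?_
  simp
end

section
/- Let k ≥ 2 be an integer, let n > 0 and a, b ∈ ℝ, and let M be the k × k real matrix indexed by {0, 1, …, k−1} with M₀₀ = 0, M₀ⱼ = Mⱼ₀ = 1/√n for 1 ≤ j ≤ k−1, Mᵢᵢ = a for 1 ≤ i ≤ k−1, and Mᵢⱼ = b for 1 ≤ i ≠ j ≤ k−1. Then det M = −((k−1)/n) (a − b)^{k−2}. -/
open Real Matrix

/-- Determinant of the bordered Hessian arising in the proof of the CLT for uncertain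
variables. -/
theorem stmt_8 (k : ℕ) (hk : 2 ≤ k) (n : ℝ) (hn : 0 < n) (a b : ℝ)
    (M : Matrix (Fin k) (Fin k) ℝ)
    (hM : ∀ i j : Fin k, M i j =
      if i.val = 0 ∧ j.val = 0 then 0
      else if i.val = 0 ∨ j.val = 0 then 1 / Real.sqrt n
      else if i = j then a else b) :
    M.det = -(((k : ℝ) - 1) / n) * (a - b) ^ (k - 2) := by
  obtain ⟨m, rfl⟩ : ∃ m, k = 1 + (m + 1) := ⟨k - 2, by omega⟩
  obtain ⟨c, hc⟩ : ∃ c, c = 1 / Real.sqrt n := ⟨_, rfl⟩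
  have hc0 : c ≠ 0 := by rw [hc]; positivity
  have hcc : c * c = 1 / n := by
    rw [hc, div_mul_div_comm, Real.mul_self_sqrt hn.le, one_mul]
  rw [← hc] at hM
  have hk2 : 1 + (m + 1) - 2 = m := by omega
  rw [hk2]
  by_cases hd : a - b = 0
  · have hab : a = b := sub_eq_zero.mp hd
    subst hab
    rcases m with _ | m
    · have h2 : M.det = M 0 0 * M 1 1 - M 0 1 * M 1 0 := Matrix.det_fin_two M
      rw [h2, hM, hM, hM, hM]
      simp [hcc]
      norm_num
    · rw [Matrix.det_zero_of_row_eq (i := ⟨1, by omega⟩) (j := ⟨2, by omega⟩)]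
      · simp
      · simp
      · funext j
        rw [hM, hM]
        simp only [ite_self]
        simp
  · obtain ⟨d, hdd⟩ : ∃ d, d = a - b := ⟨_, rfl⟩
    rw [← hdd] at hd ⊢
    have ha : a = d + b := by rw [hdd]; ring
    have hdet : M.det = (M.submatrix finSumFinEquiv finSumFinEquiv).det :=
      (Matrix.det_submatrix_equiv_self (finSumFinEquiv (m := 1) (n := m + 1)) M).symm
    have hfac : M.submatrix (finSumFinEquiv (m := 1) (n := m + 1)) finSumFinEquiv =
        fromBlocks (1 : Matrix (Fin 1) (Fin 1) ℝ) 0 (of fun _ _ => b / c) (1 : Matrix (Fin (m+1)) (Fin (m+1)) ℝ) *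
        fromBlocks (0 : Matrix (Fin 1) (Fin 1) ℝ) (of fun _ _ => c) (of fun _ _ => c)
          (diagonal fun _ => d) := by
      rw [fromBlocks_multiply]
      ext i j
      rcases i with i | i <;> rcases j with j | j
      · simp [hM]
      · simp [hM]
      · simp [hM]
      · simp only [submatrix_apply, hM, finSumFinEquiv_apply_right, fromBlocks_apply₂₂]
        by_cases hij : i = j
        · subst hij
          simp [Matrix.mul_apply, ha, hc0, add_comm]
        · simp [Matrix.mul_apply, hij, hc0]
    letI : Invertible (diagonal fun _ : Fin (m+1) => d) :=
      ⟨diagonal fun _ => d⁻¹, by simp [hd], by simp [hd]⟩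
    have hinv : ⅟(diagonal fun _ : Fin (m+1) => d) = diagonal fun _ => d⁻¹ := rfl
    rw [hdet, hfac, det_mul, det_fromBlocks_zero₁₂, det_fromBlocks₂₂, hinv]
    simp [Matrix.mul_apply, Matrix.diagonal_apply]
    have : c * d⁻¹ * c = (1 / n) * d⁻¹ := by rw [← hcc]; ring
    rw [this]
    field_simp
    ring
end

section
/- Let f : ℝ → ℝ be twice differentiable, let ξ : ℝ → ℝ be a bijection such that both ξ and its inverse ξ⁻¹ are twice differentiable, and let μ ∈ ℝ satisfy f'(μ) = 0. Then ξ'(μ) ≠ 0 and the function g = f ∘ ξ⁻¹ satisfies g''(ξ(μ)) = f''(μ) / (ξ'(μ))². In particular, if f''(μ) ≠ 0 then −1/g''(ξ(μ)) = (ξ'(μ))² · (−1/f''(μ)). -/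
/-- Transformation rule for the variance of uncertain variables: if `f'(μ) = 0` then
`ξ'(μ) ≠ 0` and `g = f ∘ ξ⁻¹` satisfies `g''(ξ(μ)) = f''(μ)/(ξ'(μ))²`; in particular
`−1/g''(ξ(μ)) = (ξ'(μ))² ⬝ (−1/f''(μ))` when `f''(μ) ≠ 0`. -/
theorem stmt_10 (f ξ ξinv : ℝ → ℝ) (μ : ℝ)
    (hf : ∀ x, DifferentiableAt ℝ f x) (hf2 : ∀ x, DifferentiableAt ℝ (deriv f) x)
    (hbij : Function.Bijective ξ)
    (hleft : Function.LeftInverse ξinv ξ) (hright : Function.RightInverse ξinv ξ)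
    (hξ : ∀ x, DifferentiableAt ℝ ξ x) (hξ2 : ∀ x, DifferentiableAt ℝ (deriv ξ) x)
    (hinv : ∀ x, DifferentiableAt ℝ ξinv x)
    (hinv2 : ∀ x, DifferentiableAt ℝ (deriv ξinv) x)
    (hμ : deriv f μ = 0) :
    deriv ξ μ ≠ 0 ∧
    deriv (deriv (f ∘ ξinv)) (ξ μ) = deriv (deriv f) μ / (deriv ξ μ) ^ 2 ∧
    (deriv (deriv f) μ ≠ 0 →
      -1 / deriv (deriv (f ∘ ξinv)) (ξ μ) =
        (deriv ξ μ) ^ 2 * (-1 / deriv (deriv f) μ)) := by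
  have h1 : deriv ξinv (ξ μ) * deriv ξ μ = 1 := by
    have h := (hinv (ξ μ)).hasDerivAt.comp μ (hξ μ).hasDerivAt
    have e : ξinv ∘ ξ = id := funext hleft
    rw [e] at h
    exact h.unique (hasDerivAt_id μ)
  have hne : deriv ξ μ ≠ 0 := right_ne_zero_of_mul_eq_one h1
  have hd : deriv ξinv (ξ μ) = 1 / deriv ξ μ := by
    field_simp
    exact h1
  have hg : deriv (f ∘ ξinv) = (deriv f ∘ ξinv) * deriv ξinv := by
    funext y
    exact ((hf (ξinv y)).hasDerivAt.comp y (hinv y).hasDerivAt).deriv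
  have hg2 : deriv (deriv (f ∘ ξinv)) (ξ μ) = deriv (deriv f) μ / (deriv ξ μ) ^ 2 := by
    have h := ((hf2 (ξinv (ξ μ))).hasDerivAt.comp (ξ μ) (hinv (ξ μ)).hasDerivAt).mul
      (hinv2 (ξ μ)).hasDerivAt
    rw [hg, h.deriv]
    simp only [Function.comp_apply, hleft μ, hμ, hd]
    field_simp
    ring
  refine ⟨hne, hg2, fun h => ?_⟩
  rw [hg2]
  field_simp
end

section
/- Let n ≥ 1, σ > 0, and θ, s ∈ ℝ. Then sup { exp( −(1/(2σ²)) ∑_{i=1}^n (yᵢ − θ)² ) : y₁, …, yₙ ∈ ℝ, (y₁ + ⋯ + yₙ)/n = s } = exp( −(n/(2σ²)) (θ − s)² ). -/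
open Real Finset

/-- The likelihood of `θ` given the sample average: maximising the joint normal possibility
function over all observation sequences with sample average `s` yields `N̄(s; θ, σ²/n)`. -/
theorem stmt_11 (n : ℕ) (hn : 1 ≤ n) (σ : ℝ) (hσ : 0 < σ) (θ s : ℝ) :
    sSup {q : ℝ | ∃ y : Fin n → ℝ, (∑ i, y i) / n = s ∧
        q = Real.exp (-(1 / (2 * σ ^ 2)) * ∑ i, (y i - θ) ^ 2)} =
      Real.exp (-((n : ℝ) / (2 * σ ^ 2)) * (θ - s) ^ 2) := by
  have hn0 : (n : ℝ) ≠ 0 := by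
    have : n ≠ 0 := by omega
    exact_mod_cast this
  apply IsGreatest.csSup_eq
  constructor
  · refine ⟨fun _ => s, ?_, ?_⟩
    · simp only [Finset.sum_const, Finset.card_univ, Fintype.card_fin, nsmul_eq_mul]
      field_simp
    · simp only [Finset.sum_const, Finset.card_univ, Fintype.card_fin, nsmul_eq_mul]
      congr 1
      ring
  · rintro q ⟨y, hy, rfl⟩
    have hsum : ∑ i, y i = n * s := by
      rw [← hy]
      field_simp
    have key : ∑ i, (y i - θ) ^ 2 = ∑ i, (y i - s) ^ 2 + n * (θ - s) ^ 2 := by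
      have h1 : ∀ i, (y i - θ) ^ 2
          = (y i - s) ^ 2 + (2 * (s - θ) * y i + (θ ^ 2 - s ^ 2)) := by
        intro i
        ring
      simp only [h1, Finset.sum_add_distrib, ← Finset.mul_sum, hsum, Finset.sum_const,
        Finset.card_univ, Fintype.card_fin, nsmul_eq_mul]
      ring
    have hnn : 0 ≤ ∑ i, (y i - s) ^ 2 := Finset.sum_nonneg fun i _ => sq_nonneg _
    have hc : 0 ≤ 1 / (2 * σ ^ 2) * ∑ i, (y i - s) ^ 2 := by positivity
    apply Real.exp_le_exp.mpr
    rw [key]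
    have : (n : ℝ) / (2 * σ ^ 2) = 1 / (2 * σ ^ 2) * n := by ring
    rw [this]
    nlinarith [hc]
end

section
/- Let n ≥ 1, k ≥ 0, α₀ ≥ 0, β₀ > 0, μ₀ ∈ ℝ and y₁, …, yₙ ∈ ℝ. Set ȳ = n^{-1}∑ yᵢ, v̂ = n^{-1}∑ (yᵢ − ȳ)², α_n = α₀ + n/2, β_n = β₀ + n v̂/2 + (n k / (2(n + k))) (μ₀ − ȳ)², and for μ ∈ ℝ and τ > 0 define G(μ, τ) = τ^{α₀ + n/2} exp( −τ ( β₀ + ½∑_{i=1}^n (yᵢ − μ)² + ½ k (μ − μ₀)² ) ). Then for every τ > 0, sup_{μ ∈ ℝ} G(μ, τ) / sup_{μ' ∈ ℝ, τ' > 0} G(μ', τ') = ((β_n τ)^{α_n} / α_n^{α_n}) exp( α_n − β_n τ ). -/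
open Real Finset

/-- Marginal posterior possibility function of the precision with a normal likelihood,
gamma prior on the precision and conditionally normal prior on the mean: it is the gamma
possibility function `Ḡ(αₙ, βₙ)`. -/
theorem stmt_16 (n : ℕ) (hn : 1 ≤ n) (k α₀ : ℝ) (hk : 0 ≤ k) (hα₀ : 0 ≤ α₀)
    (β₀ : ℝ) (hβ₀ : 0 < β₀) (μ₀ : ℝ) (y : Fin n → ℝ)
    (ybar vhat αn βn : ℝ)
    (hybar : ybar = (∑ i, y i) / n)
    (hvhat : vhat = (∑ i, (y i - ybar) ^ 2) / n)
    (hαn : αn = α₀ + n / 2)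
    (hβn : βn = β₀ + n * vhat / 2 + (n * k / (2 * (n + k))) * (μ₀ - ybar) ^ 2)
    (G : ℝ → ℝ → ℝ)
    (hG : ∀ μ τ, G μ τ = τ ^ (α₀ + n / 2) *
        Real.exp (-τ * (β₀ + (∑ i, (y i - μ) ^ 2) / 2 + k * (μ - μ₀) ^ 2 / 2))) :
    ∀ τ : ℝ, 0 < τ →
      sSup {v : ℝ | ∃ μ : ℝ, v = G μ τ} /
          sSup {v : ℝ | ∃ μ' τ' : ℝ, 0 < τ' ∧ v = G μ' τ'} =
        ((βn * τ) ^ αn / αn ^ αn) * Real.exp (αn - βn * τ) := by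
  intro τ hτ
  have hn0 : (0:ℝ) < n := by exact_mod_cast hn
  have hnk : (0:ℝ) < n + k := by linarith
  have ha : 0 < αn := by rw [hαn]; positivity
  have hv : 0 ≤ vhat := by
    rw [hvhat]; exact div_nonneg (Finset.sum_nonneg fun i _ => sq_nonneg _) hn0.le
  have hb : 0 < βn := by rw [hβn]; positivity
  have hsum : ∑ i, y i = n * ybar := by rw [hybar]; field_simp
  have hvs : ∑ i, (y i - ybar) ^ 2 = n * vhat := by rw [hvhat]; field_simp
  have hdec : ∀ μ, ∑ i, (y i - μ) ^ 2 = n * vhat + n * (ybar - μ) ^ 2 := by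
    intro μ
    have h1 : ∀ i, (y i - μ) ^ 2 =
        (y i - ybar) ^ 2 + (2 * (ybar - μ)) * y i + (μ ^ 2 - ybar ^ 2) := by
      intro i; ring
    simp only [h1, Finset.sum_add_distrib, ← Finset.mul_sum, hsum, hvs]
    simp
    ring
  obtain ⟨m, hm⟩ : ∃ m, m = (n * ybar + k * μ₀) / (n + k) := ⟨_, rfl⟩
  have hG' : ∀ μ τ, G μ τ = τ ^ αn * Real.exp (-τ * (βn + (n + k) / 2 * (μ - m) ^ 2)) := by
    intro μ τ
    rw [hG, ← hαn, hdec]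
    congr 3
    rw [hβn, hm]
    field_simp
    ring
  have hle : ∀ μ t, 0 < t → G μ t ≤ G m t := by
    intro μ t ht
    rw [hG', hG']
    apply mul_le_mul_of_nonneg_left _ (by positivity)
    apply Real.exp_le_exp.2
    have : 0 ≤ t * ((n + k) / 2 * (μ - m) ^ 2) := by positivity
    simp only [sub_self]
    nlinarith
  have hGm : ∀ t, G m t = t ^ αn * Real.exp (-t * βn) := by
    intro t; rw [hG']; simp
  have hmax : ∀ t, 0 < t → G m t ≤ G m (αn / βn) := by
    intro t ht
    have e : t = (αn / βn) * (βn * t / αn) := by field_simp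
    have hx : βn * t / αn ≤ Real.exp (βn * t / αn - 1) := by
      have := Real.add_one_le_exp (βn * t / αn - 1)
      linarith
    have hp : (βn * t / αn) ^ αn ≤ Real.exp (βn * t - αn) := by
      refine (Real.rpow_le_rpow (by positivity) hx ha.le).trans_eq ?_
      rw [← Real.exp_mul]
      congr 1
      field_simp
    rw [hGm, hGm]
    have e2 : t ^ αn = (αn / βn) ^ αn * (βn * t / αn) ^ αn := by
      rw [← Real.mul_rpow (by positivity) (by positivity), ← e]
    rw [e2, mul_assoc]
    apply mul_le_mul_of_nonneg_left _ (by positivity)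
    refine (mul_le_mul_of_nonneg_right hp (Real.exp_pos _).le).trans_eq ?_
    rw [← Real.exp_add]
    congr 1
    field_simp
    ring
  have h1 : sSup {v : ℝ | ∃ μ : ℝ, v = G μ τ} = G m τ := by
    apply IsGreatest.csSup_eq
    refine ⟨⟨m, rfl⟩, ?_⟩
    rintro v ⟨μ, rfl⟩
    exact hle μ τ hτ
  have h2 : sSup {v : ℝ | ∃ μ' τ' : ℝ, 0 < τ' ∧ v = G μ' τ'} = G m (αn / βn) := by
    apply IsGreatest.csSup_eq
    refine ⟨⟨m, _, div_pos ha hb, rfl⟩, ?_⟩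
    rintro v ⟨μ, t, ht, rfl⟩
    exact (hle μ t ht).trans (hmax t ht)
  rw [h1, h2, hGm, hGm, Real.mul_rpow hb.le hτ.le, Real.div_rpow ha.le hb.le]
  have e3 : -(αn / βn) * βn = -αn := by field_simp
  have e4 : Real.exp (αn - βn * τ) = Real.exp (-τ * βn) / Real.exp (-αn) := by
    rw [← Real.exp_sub]; congr 1; ring
  rw [e3, e4]
  have p1 : 0 < αn ^ αn := by positivity
  have p2 : 0 < βn ^ αn := by positivity
  have p3 := Real.exp_pos (-αn)
  generalize αn ^ αn = A at *
  generalize βn ^ αn = B at *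
  generalize Real.exp (-αn) = E at *
  generalize Real.exp (-τ * βn) = F at *
  field_simp
end
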